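/- arXiv:1108.4114 — 2 statements merged into one kernel-verified Lean document; each statement's English description precedes it below -/
import Mathlib

section
/- Let g be a simple graph on {1,…,n} with η_i(g) = k_i for every firm i, and let ij be a pair of distinct vertices that is not an edge of g. Then Y_i(g + ij) − Y_i(g) = −Δ⁺f(0)·((n−1)/(n+1))·(2·q_i(g) − ((n−1)/(n+1))·Δ⁺f(0)). -/
open Finset

noncomputable def degree' {n : ℕ} (g : SimpleGraph (Fin n)) (i : Fin n) : ℕ :=
  Nat.card {j | g.Adj i j}

/-- The graph `g` with the edge `ij` deleted. -/
def delE {n : ℕ} (g : SimpleGraph (Fin n)) (i j : Fin n) : SimpleGraph (Fin n) :=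
  g.deleteEdges {s(i, j)}

/-- The graph `g` with the edge `ij` added. -/
def addE {n : ℕ} (g : SimpleGraph (Fin n)) (i j : Fin n) : SimpleGraph (Fin n) :=
  g ⊔ SimpleGraph.fromEdgeSet {s(i, j)}

/-- Cournot equilibrium quantity of firm `i` under collaboration graph `g`. -/
noncomputable def qty {n : ℕ} (α γ₀ : ℝ) (f : ℝ → ℝ) (k : Fin n → ℕ)
    (g : SimpleGraph (Fin n)) (i : Fin n) : ℝ :=
  (α - γ₀ - n * f ((degree' g i : ℝ) - (k i : ℝ))
    + ∑ j ∈ univ.erase i, f ((degree' g j : ℝ) - (k j : ℝ))) / (n + 1)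

/-- Market price under collaboration graph `g`. -/
noncomputable def price {n : ℕ} (α γ₀ : ℝ) (f : ℝ → ℝ) (k : Fin n → ℕ)
    (g : SimpleGraph (Fin n)) : ℝ :=
  α - ∑ i, qty α γ₀ f k g i

/-- Marginal cost of firm `i` under collaboration graph `g`. -/
noncomputable def cost {n : ℕ} (γ₀ : ℝ) (f : ℝ → ℝ) (k : Fin n → ℕ)
    (g : SimpleGraph (Fin n)) (i : Fin n) : ℝ :=
  γ₀ + f ((degree' g i : ℝ) - (k i : ℝ))

/-- Profit of firm `i` under collaboration graph `g`. -/
noncomputable def profit {n : ℕ} (α γ₀ : ℝ) (f : ℝ → ℝ) (k : Fin n → ℕ)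
    (g : SimpleGraph (Fin n)) (i : Fin n) : ℝ :=
  qty α γ₀ f k g i * (price α γ₀ f k g - cost γ₀ f k g i)

/-- A Cournot quantity in terms of the total of all firms' cost deviations. -/
lemma qty_eq_sum_univ {n : ℕ} (α γ₀ : ℝ) (f : ℝ → ℝ) (k : Fin n → ℕ)
    (g : SimpleGraph (Fin n)) (i : Fin n) :
    qty α γ₀ f k g i = (α - γ₀ - (n + 1) * f ((degree' g i : ℝ) - (k i : ℝ))
      + ∑ j, f ((degree' g j : ℝ) - (k j : ℝ))) / (n + 1) := by
  rw [qty, ← add_sum_erase univ _ (mem_univ i)]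
  ring

/-- In equilibrium the markup of each firm equals its quantity. -/
lemma price_sub_cost {n : ℕ} (α γ₀ : ℝ) (f : ℝ → ℝ) (k : Fin n → ℕ)
    (g : SimpleGraph (Fin n)) (i : Fin n) :
    price α γ₀ f k g - cost γ₀ f k g i = qty α γ₀ f k g i := by
  have hn : (n : ℝ) + 1 ≠ 0 := by positivity
  simp only [price, cost, qty_eq_sum_univ, ← sum_div, sum_add_distrib, sum_sub_distrib,
    ← mul_sum, sum_const, card_univ, Fintype.card_fin, nsmul_eq_mul]
  field_simp
  ring

lemma profit_eq_qty_sq {n : ℕ} (α γ₀ : ℝ) (f : ℝ → ℝ) (k : Fin n → ℕ)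
    (g : SimpleGraph (Fin n)) (i : Fin n) :
    profit α γ₀ f k g i = qty α γ₀ f k g i ^ 2 := by
  rw [profit, price_sub_cost, sq]

lemma addE_comm {n : ℕ} (g : SimpleGraph (Fin n)) (i j : Fin n) :
    addE g i j = addE g j i := by
  rw [addE, addE, Sym2.eq_swap]

lemma degree'_addE_left {n : ℕ} {g : SimpleGraph (Fin n)} {i j : Fin n}
    (hne : i ≠ j) (hij : ¬ g.Adj i j) : degree' (addE g i j) i = degree' g i + 1 := by
  have h : {l | (addE g i j).Adj i l} = insert j {l | g.Adj i l} := by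
    ext l
    simp only [addE, SimpleGraph.sup_adj, SimpleGraph.fromEdgeSet_adj, Set.mem_singleton_iff,
      Sym2.eq_iff, Set.mem_ofPred_eq, Set.mem_insert_iff]
    grind
  rw [degree', degree', h, Nat.card_coe_set_eq, Nat.card_coe_set_eq,
    Set.ncard_insert_of_notMem (by simpa using hij)]

lemma degree'_addE_of_ne {n : ℕ} (g : SimpleGraph (Fin n)) {i j l : Fin n}
    (hi : l ≠ i) (hj : l ≠ j) : degree' (addE g i j) l = degree' g l := by
  have h : {m | (addE g i j).Adj l m} = {m | g.Adj l m} := by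
    ext m
    simp [addE, hi, hj]
  rw [degree', degree', h]

/-- Adding a link to a graph in which every firm has its target degree `k` lowers the quantity of
an endpoint: its own cost rises by `f 1 - f 0`, and so does that of one rival. -/
lemma qty_addE_left {n : ℕ} (α γ₀ : ℝ) (f : ℝ → ℝ) {k : Fin n → ℕ}
    {g : SimpleGraph (Fin n)} (hdeg : ∀ i, degree' g i = k i)
    {i j : Fin n} (hne : i ≠ j) (hij : ¬ g.Adj i j) :
    qty α γ₀ f k (addE g i j) i
      = qty α γ₀ f k g i - ((n : ℝ) - 1) / ((n : ℝ) + 1) * (f 1 - f 0) := by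
  have hi : (degree' (addE g i j) i : ℝ) - k i = 1 := by
    rw [degree'_addE_left hne hij, hdeg]
    push_cast
    ring
  have hj : (degree' (addE g i j) j : ℝ) - k j = 1 := by
    rw [addE_comm, degree'_addE_left hne.symm (fun h => hij h.symm), hdeg]
    push_cast
    ring
  have hmem : j ∈ univ.erase i := mem_erase.2 ⟨hne.symm, mem_univ j⟩
  have hrest : ∑ l ∈ (univ.erase i).erase j, f ((degree' (addE g i j) l : ℝ) - k l)
      = ∑ l ∈ (univ.erase i).erase j, f ((degree' g l : ℝ) - k l) := by
    refine sum_congr rfl fun l hl => ?_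
    rw [mem_erase, mem_erase] at hl
    rw [degree'_addE_of_ne g hl.2.1 hl.1]
  rw [qty, qty, ← add_sum_erase _ _ hmem, ← add_sum_erase _ _ hmem, hrest, hi, hj, hdeg i, hdeg j,
    sub_self, sub_self]
  ring

/-- profit change from adding an edge `ij`. -/
theorem stmt6 (n : ℕ) (hn : 2 ≤ n) (α γ₀ : ℝ) (f : ℝ → ℝ)
    (hconv : ConvexOn ℝ Set.univ f) (hf0 : ∀ x, 0 ≤ f x) (hfmin : ∀ x, f 0 ≤ f x)
    (k : Fin n → ℕ) (hk : ∀ i, k i ≤ n - 1)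
    (g : SimpleGraph (Fin n)) (hdeg : ∀ i, degree' g i = k i)
    (i j : Fin n) (hne : i ≠ j) (hij : ¬ g.Adj i j) :
    profit α γ₀ f k (addE g i j) i - profit α γ₀ f k g i
      = -(f 1 - f 0) * (((n : ℝ) - 1) / ((n : ℝ) + 1))
        * (2 * qty α γ₀ f k g i - (((n : ℝ) - 1) / ((n : ℝ) + 1)) * (f 1 - f 0)) := by
  rw [profit_eq_qty_sq, profit_eq_qty_sq, qty_addE_left α γ₀ f hdeg hne hij]
  ring
end

section
/- Let g be a simple graph on {1,…,n} with η_i(g) = k_i for every firm i, and let ij be an edge of g. Then for every market node l ∈ V, y_li(g − ij) − y_li(g) = −Δ⁻f(0)·((n−1)/(n+1))·(2·d_li(g) − ((n−1)/(n+1))·Δ⁻f(0)). -/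
open Finset

/-- Cournot equilibrium quantity shipped by firm `i` to market node `l`
under collaboration graph `g`. -/
noncomputable def dq {n : ℕ} {V : Type*} [Fintype V] (αl : V → ℝ) (γ₀ : ℝ)
    (s : V → Fin n → ℝ) (f : ℝ → ℝ) (k : Fin n → ℕ)
    (g : SimpleGraph (Fin n)) (l : V) (i : Fin n) : ℝ :=
  (αl l - γ₀ - n * (s l i + f ((degree' g i : ℝ) - (k i : ℝ)))
    + ∑ j ∈ univ.erase i, (s l j + f ((degree' g j : ℝ) - (k j : ℝ)))) / (n + 1)

/-- Price at market node `l` under collaboration graph `g`. -/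
noncomputable def priceAt {n : ℕ} {V : Type*} [Fintype V] (αl : V → ℝ) (γ₀ : ℝ)
    (s : V → Fin n → ℝ) (f : ℝ → ℝ) (k : Fin n → ℕ)
    (g : SimpleGraph (Fin n)) (l : V) : ℝ :=
  αl l - ∑ i, dq αl γ₀ s f k g l i

/-- Profit of firm `i` at market node `l` under collaboration graph `g`. -/
noncomputable def profitAt {n : ℕ} {V : Type*} [Fintype V] (αl : V → ℝ) (γ₀ : ℝ)
    (s : V → Fin n → ℝ) (f : ℝ → ℝ) (k : Fin n → ℕ)
    (g : SimpleGraph (Fin n)) (l : V) (i : Fin n) : ℝ :=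
  dq αl γ₀ s f k g l i * (priceAt αl γ₀ s f k g l - cost γ₀ f k g i - s l i)

/-- Total profit of firm `i` across all spatial markets under collaboration graph `g`. -/
noncomputable def totProfit {n : ℕ} {V : Type*} [Fintype V] (αl : V → ℝ) (γ₀ : ℝ)
    (s : V → Fin n → ℝ) (f : ℝ → ℝ) (k : Fin n → ℕ)
    (g : SimpleGraph (Fin n)) (i : Fin n) : ℝ :=
  ∑ l, profitAt αl γ₀ s f k g l i

/-- The equilibrium quantity in terms of the sum of the costs of all firms, `i` included. -/
lemma dq_eq {n : ℕ} {V : Type*} [Fintype V] (αl : V → ℝ) (γ₀ : ℝ)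
    (s : V → Fin n → ℝ) (f : ℝ → ℝ) (k : Fin n → ℕ)
    (g : SimpleGraph (Fin n)) (l : V) (i : Fin n) :
    dq αl γ₀ s f k g l i =
      (αl l - γ₀ + ∑ j, (s l j + f ((degree' g j : ℝ) - (k j : ℝ)))) / (n + 1)
        - (s l i + f ((degree' g i : ℝ) - (k i : ℝ))) := by
  have hn : (n : ℝ) + 1 ≠ 0 := by positivity
  rw [dq, ← add_sum_erase univ _ (mem_univ i)]
  field_simp
  ring

/-- In equilibrium, the margin of a firm equals its quantity, so its profit is a square. -/
lemma profitAt_eq_sq {n : ℕ} {V : Type*} [Fintype V] (αl : V → ℝ) (γ₀ : ℝ)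
    (s : V → Fin n → ℝ) (f : ℝ → ℝ) (k : Fin n → ℕ)
    (g : SimpleGraph (Fin n)) (l : V) (i : Fin n) :
    profitAt αl γ₀ s f k g l i = dq αl γ₀ s f k g l i ^ 2 := by
  have hn : (n : ℝ) + 1 ≠ 0 := by positivity
  have margin : priceAt αl γ₀ s f k g l - cost γ₀ f k g i - s l i = dq αl γ₀ s f k g l i := by
    simp only [priceAt, cost, dq_eq, sum_sub_distrib, sum_const, card_univ, Fintype.card_fin,
      nsmul_eq_mul]
    field_simp
    ring
  rw [profitAt, margin, sq]

lemma delE_comm {n : ℕ} (g : SimpleGraph (Fin n)) (i j : Fin n) : delE g i j = delE g j i := by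
  rw [delE, delE, Sym2.eq_swap]

lemma degree'_delE_left {n : ℕ} {g : SimpleGraph (Fin n)} {i j : Fin n} (hij : g.Adj i j) :
    degree' (delE g i j) i + 1 = degree' g i := by
  have h : {x | (delE g i j).Adj i x} = {x | g.Adj i x} \ {j} := by
    ext x
    simp [delE, hij.ne]
  rw [degree', degree', h, Nat.card_coe_set_eq, Nat.card_coe_set_eq]
  exact Set.ncard_sdiff_singleton_add_one hij

lemma degree'_delE_right {n : ℕ} {g : SimpleGraph (Fin n)} {i j : Fin n} (hij : g.Adj i j) :
    degree' (delE g i j) j + 1 = degree' g j := by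
  rw [delE_comm, degree'_delE_left hij.symm]

lemma degree'_delE_of_ne {n : ℕ} (g : SimpleGraph (Fin n)) {i j m : Fin n}
    (hi : m ≠ i) (hj : m ≠ j) : degree' (delE g i j) m = degree' g m := by
  simp [degree', delE, hi, hj]

/-- nodewise profit change from deleting an edge `ij`. -/
theorem stmt14 (n : ℕ) (hn : 2 ≤ n) (V : Type*) [Fintype V] (αl : V → ℝ) (γ₀ : ℝ)
    (s : V → Fin n → ℝ) (hs : ∀ l i, 0 ≤ s l i) (f : ℝ → ℝ)
    (hconv : ConvexOn ℝ Set.univ f) (hf0 : ∀ x, 0 ≤ f x) (hfmin : ∀ x, f 0 ≤ f x)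
    (k : Fin n → ℕ) (hk : ∀ i, k i ≤ n - 1)
    (g : SimpleGraph (Fin n)) (hdeg : ∀ i, degree' g i = k i)
    (i j : Fin n) (hij : g.Adj i j) :
    ∀ l : V,
      profitAt αl γ₀ s f k (delE g i j) l i - profitAt αl γ₀ s f k g l i
        = -(f (-1) - f 0) * (((n : ℝ) - 1) / ((n : ℝ) + 1))
          * (2 * dq αl γ₀ s f k g l i - (((n : ℝ) - 1) / ((n : ℝ) + 1)) * (f (-1) - f 0)) := by
  intro l
  have hn' : (n : ℝ) + 1 ≠ 0 := by positivity
  have cost_left : (degree' (delE g i j) i : ℝ) - k i = -1 := by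
    rw [← hdeg i, ← degree'_delE_left hij]
    push_cast
    ring
  have cost_right : (degree' (delE g i j) j : ℝ) - k j = -1 := by
    rw [← hdeg j, ← degree'_delE_right hij]
    push_cast
    ring
  have hj : j ∈ univ.erase i := mem_erase.2 ⟨hij.ne', mem_univ j⟩
  have rest : ∑ m ∈ (univ.erase i).erase j,
        (s l m + f ((degree' (delE g i j) m : ℝ) - (k m : ℝ))) =
      ∑ m ∈ (univ.erase i).erase j, (s l m + f ((degree' g m : ℝ) - (k m : ℝ))) := by
    refine sum_congr rfl fun m hm => ?_
    simp only [mem_erase, mem_univ, and_true] at hm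
    rw [degree'_delE_of_ne g hm.2 hm.1]
  have quantity : dq αl γ₀ s f k (delE g i j) l i =
      dq αl γ₀ s f k g l i - ((n : ℝ) - 1) / ((n : ℝ) + 1) * (f (-1) - f 0) := by
    rw [dq, dq, ← add_sum_erase _ _ hj, ← add_sum_erase _ _ hj, rest, cost_left, cost_right,
      hdeg i, hdeg j, sub_self, sub_self]
    field_simp
    ring
  rw [profitAt_eq_sq, profitAt_eq_sq, quantity]
  ring
end
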